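/- arXiv:2204.03587 — 2 statements merged into one kernel-verified Lean document; each statement's English description precedes it below -/
import Mathlib

section
/- Let M be a bounded open subset of ℝ² with finite Lebesgue measure λ, let K be a bistochastic kernel on M, let ω ∈ L^∞(M), and set ω₁ := Kω. Suppose there exists one strictly convex continuous function f : ℝ → ℝ such that ∫_M f(ω₁) dλ = ∫_M f(ω) dλ. Then ω₁ and ω are equimeasurable: for all real a < b, λ({x ∈ M : a < ω₁(x) < b}) = λ({x ∈ M : a < ω(x) < b}); in particular ‖ω₁‖_{L^p(M)} = ‖ω‖_{L^p(M)} for every 1 ≤ p < ∞. -/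
open MeasureTheory ProbabilityTheory

/-- A bistochastic kernel on a measure space `(X, μ)`. -/
def IsBistochastic {X : Type*} [MeasurableSpace X] (μ : Measure X)
    (κ : Kernel X X) : Prop :=
  IsMarkovKernel κ ∧ ∀ A : Set X, MeasurableSet A → ∫⁻ x, κ x A ∂μ = μ A

/-- `(Kω)(x) := ∫ ω(y) dκ_x(y)`. -/
noncomputable def kernApply {X : Type*} [MeasurableSpace X]
    (κ : Kernel X X) (ω : X → ℝ) (x : X) : ℝ :=
  ∫ y, ω y ∂(κ x)

open Filter

/-- An essentially bounded function is almost everywhere bounded by its `L^∞` norm. -/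
theorem MeasureTheory.MemLp.ae_norm_le_toReal_eLpNorm_top {X E : Type*} [MeasurableSpace X]
    [NormedAddCommGroup E] {μ : Measure X} {g : X → E} (hg : MemLp g ⊤ μ) :
    ∀ᵐ x ∂μ, ‖g x‖ ≤ (eLpNorm g ⊤ μ).toReal := by
  rw [eLpNorm_exponent_top]
  filter_upwards [ae_le_eLpNormEssSup (f := g) (μ := μ)] with x hx
  rw [← toReal_enorm]
  exact ENNReal.toReal_mono (by simpa using hg.2.ne) hx

namespace IsBistochastic

variable {X : Type*} [MeasurableSpace X] {μ : Measure X} {κ : Kernel X X} {ω : X → ℝ}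

/-- A bistochastic kernel leaves the reference measure invariant. -/
theorem bind_eq (hκ : IsBistochastic μ κ) : μ.bind κ = μ := by
  ext A hA
  rw [Measure.bind_apply hA κ.aemeasurable, hκ.2 A hA]

theorem ae_ae (hκ : IsBistochastic μ κ) {p : X → Prop} (hp : ∀ᵐ y ∂μ, p y) :
    ∀ᵐ x ∂μ, ∀ᵐ y ∂κ x, p y := by
  rw [← hκ.bind_eq] at hp
  exact Measure.ae_ae_of_ae_comp hp

theorem ae_integrable (hκ : IsBistochastic μ κ) (hω : Integrable ω μ) :
    ∀ᵐ x ∂μ, Integrable ω (κ x) := by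
  rw [← hκ.bind_eq] at hω
  exact Measure.ae_integrable_of_integrable_comp hω

theorem integrable_kernApply (hκ : IsBistochastic μ κ) (hω : Integrable ω μ) :
    Integrable (kernApply κ ω) μ := by
  rw [← hκ.bind_eq, Measure.comp_eq_comp_const_apply] at hω
  simpa using! hω.integral_comp

theorem integral_kernApply (hκ : IsBistochastic μ κ) (hω : Integrable ω μ) :
    ∫ x, kernApply κ ω x ∂μ = ∫ x, ω x ∂μ := by
  have h := hω
  rw [← hκ.bind_eq, Measure.comp_eq_comp_const_apply] at h
  have h' := Kernel.integral_comp h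
  rw [← Measure.comp_eq_comp_const_apply, hκ.bind_eq] at h'
  simpa using! h'.symm

theorem memLp_top_kernApply [IsFiniteMeasure μ] (hκ : IsBistochastic μ κ) (hω : MemLp ω ⊤ μ) :
    MemLp (kernApply κ ω) ⊤ μ := by
  have := hκ.1
  refine memLp_top_of_bound (hκ.integrable_kernApply (hω.integrable le_top)).1
    (eLpNorm ω ⊤ μ).toReal ?_
  filter_upwards [hκ.ae_ae hω.ae_norm_le_toReal_eLpNorm_top] with x hx
  simpa [kernApply] using norm_integral_le_of_norm_le_const hx

/-- Equality in Jensen's inequality for a strictly convex function forces `ω` to be constant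
with respect to almost every transition probability. -/
theorem ae_ae_eq_kernApply (hκ : IsBistochastic μ κ) (hω : Integrable ω μ)
    {f : ℝ → ℝ} (hfc : Continuous f) (hf : StrictConvexOn ℝ Set.univ f)
    (hfω : Integrable (f ∘ ω) μ) (hfKω : Integrable (f ∘ kernApply κ ω) μ)
    (heq : ∫ x, f (kernApply κ ω x) ∂μ = ∫ x, f (ω x) ∂μ) :
    ∀ᵐ x ∂μ, ∀ᵐ y ∂κ x, ω y = kernApply κ ω x := by
  have := hκ.1
  have hle : f ∘ kernApply κ ω ≤ᵐ[μ] kernApply κ (f ∘ ω) := by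
    filter_upwards [hκ.ae_integrable hω, hκ.ae_integrable hfω] with x hx hfx
    exact hf.convexOn.map_integral_le hfc.continuousOn isClosed_univ (by simp) hx hfx
  have hae := (integral_eq_iff_of_ae_le hfKω (hκ.integrable_kernApply hfω) hle).1
    (heq.trans (hκ.integral_kernApply hfω).symm)
  filter_upwards [hκ.ae_integrable hω, hκ.ae_integrable hfω, hae] with x hx hfx hex
  rcases hf.ae_eq_const_or_map_average_lt hfc.continuousOn isClosed_univ (by simp) hx hfx
    with h | h
  · simpa [average_eq_integral] using! h
  · rw [average_eq_integral, average_eq_integral] at h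
    exact absurd hex h.ne

/-- If almost every transition probability sees `ω` as a constant, then `kernApply κ ω` and `ω`
have the same distribution. -/
theorem identDistrib_kernApply (hκ : IsBistochastic μ κ) (hω : Integrable ω μ)
    (h : ∀ᵐ x ∂μ, ∀ᵐ y ∂κ x, ω y = kernApply κ ω x) :
    IdentDistrib (kernApply κ ω) ω μ μ := by
  have := hκ.1
  have hKm := (hκ.integrable_kernApply hω).1.aemeasurable
  refine ⟨hKm, hω.1.aemeasurable, ?_⟩
  ext A hA
  have hnull : NullMeasurableSet (ω ⁻¹' A) μ := hω.1.aemeasurable.nullMeasurableSet_preimage hA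
  rw [Measure.map_apply_of_aemeasurable hKm hA,
    Measure.map_apply_of_aemeasurable hω.1.aemeasurable hA]
  obtain ⟨B, hB, hBA⟩ := hnull.exists_measurable_superset_ae_eq.imp fun _ h ↦ h.2
  rw [← measure_congr hBA, ← hκ.2 B hB,
    ← lintegral_indicator_one₀ (hKm.nullMeasurableSet_preimage hA)]
  refine lintegral_congr_ae ?_
  filter_upwards [h, hκ.ae_ae hBA] with x hx hxB
  rw [measure_congr hxB]
  by_cases hxA : kernApply κ ω x ∈ A
  · have hset : ω ⁻¹' A =ᵐ[κ x] Set.univ :=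
      eventuallyEq_univ.2 (hx.mono fun y hy ↦ by simpa [hy] using hxA)
    rw [measure_congr hset, Set.indicator_of_mem (by exact hxA)]
    simp
  · have hset : ω ⁻¹' A =ᵐ[κ x] (∅ : Set X) :=
      eventuallyEq_empty.2 (hx.mono fun y hy ↦ by simpa [hy] using hxA)
    rw [measure_congr hset, Set.indicator_of_notMem (by exact hxA)]
    simp

end IsBistochastic

/-- A continuous function of an essentially bounded function is integrable over a finite
measure. -/
theorem Continuous.integrable_comp_of_memLp_top {X : Type*} [MeasurableSpace X] {μ : Measure X}
    [IsFiniteMeasure μ] {f : ℝ → ℝ} (hf : Continuous f) {g : X → ℝ} (hg : MemLp g ⊤ μ) :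
    Integrable (f ∘ g) μ := by
  obtain ⟨C, hC⟩ := (isCompact_closedBall (0 : ℝ)
    (eLpNorm g ⊤ μ).toReal).exists_bound_of_continuousOn hf.continuousOn
  refine Integrable.of_bound (hf.comp_aestronglyMeasurable hg.1) C ?_
  filter_upwards [hg.ae_norm_le_toReal_eLpNorm_top] with x hx
  exact hC _ (by simpa using hx)

/-- if one strictly convex Casimir is conserved under a bistochastic
operator, then `Kω` and `ω` are equimeasurable, and all `L^p` norms agree. -/
theorem equal_strictConvex_casimir_implies_equimeasurable
    (M : Set (ℝ × ℝ)) (hMopen : IsOpen M) (hMbdd : Bornology.IsBounded M)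
    (κ : Kernel (ℝ × ℝ) (ℝ × ℝ)) (hκ : IsBistochastic (volume.restrict M) κ)
    (ω : ℝ × ℝ → ℝ) (hω : MemLp ω ⊤ (volume.restrict M))
    (ω₁ : ℝ × ℝ → ℝ) (hω₁ : ω₁ = kernApply κ ω)
    (f : ℝ → ℝ) (hfc : Continuous f) (hfconv : StrictConvexOn ℝ Set.univ f)
    (heq : ∫ x, f (ω₁ x) ∂(volume.restrict M) = ∫ x, f (ω x) ∂(volume.restrict M)) :
    (∀ a b : ℝ, a < b →
      volume.restrict M {x | a < ω₁ x ∧ ω₁ x < b}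
        = volume.restrict M {x | a < ω x ∧ ω x < b}) ∧
    (∀ p : ℝ, 1 ≤ p →
      eLpNorm ω₁ (ENNReal.ofReal p) (volume.restrict M)
        = eLpNorm ω (ENNReal.ofReal p) (volume.restrict M)) := by
  have : IsFiniteMeasure (volume.restrict M) :=
    isFiniteMeasure_restrict.2 hMbdd.measure_lt_top.ne
  subst hω₁
  have hω_int := hω.integrable le_top
  have hid := hκ.identDistrib_kernApply hω_int <|
    hκ.ae_ae_eq_kernApply hω_int hfc hfconv (hfc.integrable_comp_of_memLp_top hω)
      (hfc.integrable_comp_of_memLp_top (hκ.memLp_top_kernApply hω)) heq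
  exact ⟨fun a b _ ↦ hid.measure_mem_eq measurableSet_Ioo, fun p _ ↦ hid.eLpNorm_eq _⟩
end

section
/- Let M be a bounded open subset of ℝ² with finite Lebesgue measure λ, let f : ℝ → ℝ be strictly convex and continuous, let S ⊆ L^∞(M), and let ω* ∈ S satisfy ∫_M f(ω*) dλ ≤ ∫_M f(ω) dλ for all ω ∈ S. Then for every ω ∈ S such that ω = Kω* almost everywhere for some bistochastic kernel K on M, one has ∫_M g(ω) dλ = ∫_M g(ω*) dλ for every convex continuous function g : ℝ → ℝ, and moreover ω is equimeasurable with ω*, i.e. λ({a < ω < b}) = λ({a < ω* < b}) for all real a < b. -/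
open MeasureTheory ProbabilityTheory

/-- A measurable function whose restriction to almost every fibre of a bistochastic kernel is
a.e. constant has the same law as its image under the kernel. -/
theorem IsBistochastic.identDistrib_kernApply_s9 {X : Type*} [MeasurableSpace X] {μ : Measure X}
    {κ : Kernel X X} (hκ : IsBistochastic μ κ) {w : X → ℝ} (hw : Measurable w)
    (hconst : ∀ᵐ x ∂μ, w =ᵐ[κ x] Function.const X (kernApply κ w x)) :
    IdentDistrib (kernApply κ w) w μ μ := by
  have := hκ.1
  have hv : Measurable (kernApply κ w) := hw.stronglyMeasurable.integral_kernel.measurable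
  refine ⟨hv.aemeasurable, hw.aemeasurable, ?_⟩
  ext B hB
  rw [Measure.map_apply hv hB, Measure.map_apply hw hB, ← hκ.2 _ (hw hB),
    ← lintegral_indicator_one (hv hB)]
  refine lintegral_congr_ae ?_
  filter_upwards [hconst] with x hx
  by_cases hxB : kernApply κ w x ∈ B
  · have h : ∀ᵐ y ∂(κ x), y ∈ w ⁻¹' B := by
      filter_upwards [hx] with y hy
      rw [Set.mem_preimage, hy]
      exact hxB
    simp [Set.indicator, hxB, (mem_ae_iff_prob_eq_one (hw hB)).1 h]
  · have h : κ x (w ⁻¹' B) = 0 := by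
      rw [measure_eq_zero_iff_ae_notMem]
      filter_upwards [hx] with y hy
      rw [Set.mem_preimage, hy]
      exact hxB
    simp [Set.indicator, hxB, h]

theorem IsBistochastic.comp_eq {X : Type*} [MeasurableSpace X] {μ : Measure X}
    {κ : Kernel X X} (hκ : IsBistochastic μ κ) : κ ∘ₘ μ = μ := by
  ext A hA
  rw [Measure.bind_apply hA κ.aemeasurable, hκ.2 A hA]

/-- Equality in the integrated Jensen inequality for a strictly convex function forces a bounded
function to be a.e. constant on almost every fibre of a bistochastic kernel. -/
theorem IsBistochastic.ae_eq_const_of_integral_le {X : Type*} [MeasurableSpace X]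
    {μ : Measure X} [IsFiniteMeasure μ] {κ : Kernel X X} (hκ : IsBistochastic μ κ)
    {f : ℝ → ℝ} (hfc : Continuous f) (hfconv : StrictConvexOn ℝ Set.univ f)
    {w : X → ℝ} (hw : Measurable w) {C : ℝ} (hC : ∀ x, w x ∈ Set.Icc (-C) C)
    (hle : ∫ x, f (w x) ∂μ ≤ ∫ x, f (kernApply κ w x) ∂μ) :
    ∀ᵐ x ∂μ, w =ᵐ[κ x] Function.const X (kernApply κ w x) := by
  have := hκ.1
  obtain ⟨D, hD⟩ := isCompact_Icc.exists_bound_of_continuousOn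
    (hfc.continuousOn (s := Set.Icc (-C) C))
  have hwint (ν : Measure X) [IsFiniteMeasure ν] : Integrable w ν :=
    .of_bound hw.aestronglyMeasurable C (.of_forall fun x ↦ abs_le.2 (hC x))
  have hfw : Measurable fun x ↦ f (w x) := hfc.measurable.comp hw
  have hfwint (ν : Measure X) [IsFiniteMeasure ν] : Integrable (fun x ↦ f (w x)) ν :=
    .of_bound hfw.aestronglyMeasurable D (.of_forall fun x ↦ hD _ (hC x))
  have hv : Measurable (kernApply κ w) := hw.stronglyMeasurable.integral_kernel.measurable
  have hvC (x : X) : kernApply κ w x ∈ Set.Icc (-C) C :=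
    (convex_Icc _ _).integral_mem isClosed_Icc (.of_forall hC) (hwint _)
  have hfvint : Integrable (fun x ↦ f (kernApply κ w x)) μ :=
    .of_bound (hfc.measurable.comp hv).aestronglyMeasurable D (.of_forall fun x ↦ hD _ (hvC x))
  have hkint : Integrable (fun x ↦ ∫ y, f (w y) ∂(κ x)) μ :=
    .of_bound hfw.stronglyMeasurable.integral_kernel.aestronglyMeasurable D
      (.of_forall fun x ↦ by
        simpa using norm_integral_le_of_norm_le_const (μ := κ x) (.of_forall fun y ↦ hD _ (hC y)))
  have hjensen (x : X) : f (kernApply κ w x) ≤ ∫ y, f (w y) ∂(κ x) :=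
    hfconv.convexOn.map_integral_le hfc.continuousOn isClosed_univ (by simp) (hwint _) (hfwint _)
  have hkeq : ∫ x, ∫ y, f (w y) ∂(κ x) ∂μ = ∫ x, f (w x) ∂μ := by
    have hcomp : (κ ∘ₖ Kernel.const Unit μ) () = μ := by
      rw [Kernel.comp_apply, Kernel.const_apply, hκ.comp_eq]
    have h := Kernel.integral_comp (η := κ) (κ := Kernel.const Unit μ) (a := ())
      (f := fun x ↦ f (w x)) (by rw [hcomp]; exact hfwint μ)
    rw [hcomp, Kernel.const_apply] at h
    exact h.symm
  have hae : (fun x ↦ f (kernApply κ w x)) =ᵐ[μ] fun x ↦ ∫ y, f (w y) ∂(κ x) :=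
    (integral_eq_iff_of_ae_le hfvint hkint (.of_forall hjensen)).1
      (le_antisymm (integral_mono hfvint hkint hjensen) (hkeq.trans_le hle))
  filter_upwards [hae] with x hx
  have h := hfconv.ae_eq_const_or_map_average_lt hfc.continuousOn isClosed_univ (by simp)
    (hwint (κ x)) (hfwint (κ x))
  simp only [average_eq_integral] at h
  exact h.resolve_right hx.not_lt

/-- An essentially bounded real function has a measurable representative bounded everywhere. -/
theorem MeasureTheory.MemLp.exists_measurable_mem_Icc {X : Type*} [MeasurableSpace X]
    {μ : Measure X} {u : X → ℝ} (hu : MemLp u ⊤ μ) :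
    ∃ w : X → ℝ, Measurable w ∧ u =ᵐ[μ] w ∧ ∃ C : ℝ, ∀ x, w x ∈ Set.Icc (-C) C := by
  obtain ⟨w, hw, huw⟩ := hu.aestronglyMeasurable.aemeasurable
  set C : ℝ := (eLpNormEssSup u μ).toReal
  have hC0 : 0 ≤ C := ENNReal.toReal_nonneg
  have hbound : ∀ᵐ x ∂μ, |u x| ≤ C := by
    filter_upwards [ae_le_eLpNormEssSup (f := u) (μ := μ)] with x hx
    simpa using ENNReal.toReal_mono (eLpNorm_exponent_top (f := u) ▸ hu.eLpNorm_ne_top) hx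
  refine ⟨fun x ↦ max (-C) (min C (w x)), by fun_prop, ?_, C, fun x ↦
    ⟨le_max_left _ _, max_le (by linarith) (min_le_left _ _)⟩⟩
  filter_upwards [huw, hbound] with x hx hxC
  rw [← hx, min_eq_right (abs_le.1 hxC).2, max_eq_right (abs_le.1 hxC).1]

/-- a minimizer of a strictly convex Casimir over `S` is minimal:
any further mixing of it inside `S` conserves all convex Casimirs and is
equimeasurable with it. -/
theorem minimizers_are_minimal
    (M : Set (ℝ × ℝ)) (hMopen : IsOpen M) (hMbdd : Bornology.IsBounded M)
    (f : ℝ → ℝ) (hfc : Continuous f) (hfconv : StrictConvexOn ℝ Set.univ f)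
    (S : Set ((ℝ × ℝ) → ℝ)) (hS : ∀ ω ∈ S, MemLp ω ⊤ (volume.restrict M))
    (ωstar : ℝ × ℝ → ℝ) (hωstarS : ωstar ∈ S)
    (hmin : ∀ ω ∈ S, ∫ x, f (ωstar x) ∂(volume.restrict M)
        ≤ ∫ x, f (ω x) ∂(volume.restrict M)) :
    ∀ ω ∈ S, (∃ κ : Kernel (ℝ × ℝ) (ℝ × ℝ), IsBistochastic (volume.restrict M) κ ∧
        ω =ᵐ[volume.restrict M] kernApply κ ωstar) →
      ((∀ g : ℝ → ℝ, Continuous g → ConvexOn ℝ Set.univ g →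
          ∫ x, g (ω x) ∂(volume.restrict M) = ∫ x, g (ωstar x) ∂(volume.restrict M)) ∧
        ∀ a b : ℝ, a < b →
          volume.restrict M {x | a < ω x ∧ ω x < b}
            = volume.restrict M {x | a < ωstar x ∧ ωstar x < b}) := by
  rintro ω hω ⟨κ, hκ, hωκ⟩
  have : IsFiniteMeasure (volume.restrict M) :=
    isFiniteMeasure_restrict.2 hMbdd.measure_lt_top.ne
  obtain ⟨w, hw, hsw, C, hC⟩ := (hS _ hωstarS).exists_measurable_mem_Icc
  have hfibre : ∀ᵐ x ∂(volume.restrict M), ωstar =ᵐ[κ x] w :=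
    Measure.ae_ae_of_ae_comp (hκ.comp_eq.symm ▸ hsw)
  have hωv : ω =ᵐ[volume.restrict M] kernApply κ w := by
    filter_upwards [hωκ, hfibre] with x hx hx'
    rw [hx]
    exact integral_congr_ae hx'
  have hle : ∫ x, f (w x) ∂(volume.restrict M) ≤ ∫ x, f (kernApply κ w x) ∂(volume.restrict M) :=
    (integral_congr_ae (hsw.fun_comp f)).symm.trans_le
      ((hmin ω hω).trans_eq (integral_congr_ae (hωv.fun_comp f)))
  have hvw := hκ.identDistrib_kernApply_s9 hw (hκ.ae_eq_const_of_integral_le hfc hfconv hw hC hle)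
  have hid : IdentDistrib ω ωstar (volume.restrict M) (volume.restrict M) :=
    ((IdentDistrib.of_ae_eq hvw.aemeasurable_fst hωv.symm).symm.trans hvw).trans
      (.of_ae_eq hw.aemeasurable hsw.symm)
  exact ⟨fun g hg _ ↦ (hid.comp hg.measurable).integral_eq,
    fun a b _ ↦ hid.measure_mem_eq measurableSet_Ioo⟩
end
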